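/- Soundness of summarization: let ς̂I be the initial abstract state of a program and suppose p ≡ ς̂I ⇒* ς̂. Then, after the summarization algorithm terminates: (1) if ς̂ is not a final state, then (|CE_p(ς̂)|_al, |ς̂|_al) ∈ Seen; (2) if ς̂ is a final state, then |ς̂|_al ∈ Final; and (3) if ς̂ is an Exit-CEval and ς̂′ ∈ CE*_p(ς̂), then (|ς̂′|_al, |ς̂|_al) ∈ Seen. -/

import Mathlib

set_option autoImplicit true
set_option maxHeartbeats 1000000

namespace CFA2

/-! ## Syntax of Partitioned CPS -/

abbrev UVar := ℕ
abbrev CVar := ℕ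
abbrev Lab := ℕ
abbrev Var := UVar ⊕ CVar

mutual
  inductive ULam : Type
    | mk (l : Lab) (u : UVar) (k : CVar) (body : Call)
  inductive CLam : Type
    | mk (g : Lab) (u : UVar) (body : Call)
  inductive UExp : Type
    | lam (f : ULam)
    | var (v : UVar)
  inductive CExp : Type
    | lam (f : CLam)
    | var (k : CVar)
  inductive Call : Type
    | u (l : Lab) (f : UExp) (e : UExp) (q : CExp)
    | c (g : Lab) (q : CExp) (e : UExp)
end

def Call.lab : Call → Lab
  | .u l _ _ _ => l
  | .c g _ _ => g

-- Bound variables of a term.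
mutual
  def ULam.bv : ULam → Set Var
    | .mk _ u k body => insert (Sum.inl u) (insert (Sum.inr k) (Call.bv body))
  def CLam.bv : CLam → Set Var
    | .mk _ u body => insert (Sum.inl u) (Call.bv body)
  def UExp.bv : UExp → Set Var
    | .lam f => ULam.bv f
    | .var _ => ∅
  def CExp.bv : CExp → Set Var
    | .lam f => CLam.bv f
    | .var _ => ∅
  def Call.bv : Call → Set Var
    | .u _ f e q => UExp.bv f ∪ UExp.bv e ∪ CExp.bv q
    | .c _ q e => CExp.bv q ∪ UExp.bv e
end

-- The list of all binding occurrences of variables.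
mutual
  def ULam.binders : ULam → List Var
    | .mk _ u k body => Sum.inl u :: Sum.inr k :: Call.binders body
  def CLam.binders : CLam → List Var
    | .mk _ u body => Sum.inl u :: Call.binders body
  def UExp.binders : UExp → List Var
    | .lam f => ULam.binders f
    | .var _ => []
  def CExp.binders : CExp → List Var
    | .lam f => CLam.binders f
    | .var _ => []
  def Call.binders : Call → List Var
    | .u _ f e q => UExp.binders f ++ UExp.binders e ++ CExp.binders q
    | .c _ q e => CExp.binders q ++ UExp.binders e
end

/-- A program is alphatized: all variables have distinct names. -/
def Alphatized (pr : ULam) : Prop := (ULam.binders pr).Nodup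

/-! ## Label groups, LV, LL, stack/heap references -/

-- Labels of a term that belong to the group of the enclosing user lambda
-- (we do not descend into nested user lambdas).
mutual
  def ULam.groupLabs : ULam → Set Lab
    | .mk l _ _ body => insert l (Call.topLabs body)
  def CLam.topLabs : CLam → Set Lab
    | .mk g _ body => insert g (Call.topLabs body)
  def UExp.topLabs : UExp → Set Lab
    | .lam _ => ∅
    | .var _ => ∅
  def CExp.topLabs : CExp → Set Lab
    | .lam f => CLam.topLabs f
    | .var _ => ∅
  def Call.topLabs : Call → Set Lab
    | .u l f e q => insert l (UExp.topLabs f ∪ UExp.topLabs e ∪ CExp.topLabs q)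
    | .c g q e => insert g (CExp.topLabs q ∪ UExp.topLabs e)
end

-- Variables bound by the lambdas whose labels belong to the group of the
-- enclosing user lambda.
mutual
  def ULam.groupVars : ULam → Set Var
    | .mk _ u k body => insert (Sum.inl u) (insert (Sum.inr k) (Call.topVars body))
  def CLam.topVars : CLam → Set Var
    | .mk _ u body => insert (Sum.inl u) (Call.topVars body)
  def UExp.topVars : UExp → Set Var
    | .lam _ => ∅
    | .var _ => ∅
  def CExp.topVars : CExp → Set Var
    | .lam f => CLam.topVars f
    | .var _ => ∅
  def Call.topVars : Call → Set Var
    | .u _ f e q => UExp.topVars f ∪ UExp.topVars e ∪ CExp.topVars q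
    | .c _ q e => CExp.topVars q ∪ UExp.topVars e
end

-- User lambdas occurring as subterms.
mutual
  def ULam.subULams : ULam → Set ULam
    | .mk l u k body => insert (.mk l u k body) (Call.subULams body)
  def CLam.subULams : CLam → Set ULam
    | .mk _ _ body => Call.subULams body
  def UExp.subULams : UExp → Set ULam
    | .lam f => ULam.subULams f
    | .var _ => ∅
  def CExp.subULams : CExp → Set ULam
    | .lam f => CLam.subULams f
    | .var _ => ∅
  def Call.subULams : Call → Set ULam
    | .u _ f e q => UExp.subULams f ∪ UExp.subULams e ∪ CExp.subULams q
    | .c _ q e => CExp.subULams q ∪ UExp.subULams e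
end

-- Continuation lambdas occurring as subterms.
mutual
  def ULam.subCLams : ULam → Set CLam
    | .mk _ _ _ body => Call.subCLams body
  def CLam.subCLams : CLam → Set CLam
    | .mk g u body => insert (.mk g u body) (Call.subCLams body)
  def UExp.subCLams : UExp → Set CLam
    | .lam f => ULam.subCLams f
    | .var _ => ∅
  def CExp.subCLams : CExp → Set CLam
    | .lam f => CLam.subCLams f
    | .var _ => ∅
  def Call.subCLams : Call → Set CLam
    | .u _ f e q => UExp.subCLams f ∪ UExp.subCLams e ∪ CExp.subCLams q
    | .c _ q e => CExp.subCLams q ∪ UExp.subCLams e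
end

-- Call sites occurring as subterms.
mutual
  def ULam.subCalls : ULam → Set Call
    | .mk _ _ _ body => Call.subCalls body
  def CLam.subCalls : CLam → Set Call
    | .mk _ _ body => Call.subCalls body
  def UExp.subCalls : UExp → Set Call
    | .lam f => ULam.subCalls f
    | .var _ => ∅
  def CExp.subCalls : CExp → Set Call
    | .lam f => CLam.subCalls f
    | .var _ => ∅
  def Call.subCalls : Call → Set Call
    | .u l f e q => insert (.u l f e q) (UExp.subCalls f ∪ UExp.subCalls e ∪ CExp.subCalls q)
    | .c g q e => insert (.c g q e) (CExp.subCalls q ∪ UExp.subCalls e)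
end

/-- `LV pr ψ`: the variables bound by the lambdas whose labels lie in the same
group as label `ψ` (labels grouped by innermost enclosing user lambda). -/
def LV (pr : ULam) (ψ : Lab) : Set Var :=
  {v | ∃ ul ∈ ULam.subULams pr, ψ ∈ ULam.groupLabs ul ∧ v ∈ ULam.groupVars ul}

/-- `LL pr ψ`: the labels in the same group as `ψ`. -/
def LL (pr : ULam) (ψ : Lab) : Set Lab :=
  {ψ' | ∃ ul ∈ ULam.subULams pr, ψ ∈ ULam.groupLabs ul ∧ ψ' ∈ ULam.groupLabs ul}

-- Variables referenced (as immediate operands) at a call site.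
def UExp.refVars : UExp → Set Var
  | .var v => {Sum.inl v}
  | .lam _ => ∅
def CExp.refVars : CExp → Set Var
  | .var k => {Sum.inr k}
  | .lam _ => ∅
def Call.refVars : Call → Set Var
  | .u _ f e q => UExp.refVars f ∪ UExp.refVars e ∪ CExp.refVars q
  | .c _ q e => CExp.refVars q ∪ UExp.refVars e

/-- A heap variable: a user variable some of whose references are heap references. -/
def HVar (pr : ULam) (u : UVar) : Prop :=
  ∃ call ∈ ULam.subCalls pr, Sum.inl u ∈ Call.refVars call ∧ Sum.inl u ∉ LV pr (Call.lab call)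

/-! ## Concrete semantics (Fig. 2) -/

abbrev Time := List Lab
abbrev BEnv := Var → Option Time

structure UClos where
  lam : ULam
  env : BEnv

inductive CClos : Type
  | clo (lam : CLam) (env : BEnv)
  | halt

abbrev Clos := UClos ⊕ CClos
abbrev VEnv := Var → Time → Option Clos

def updB (β : BEnv) (v : Var) (t : Time) : BEnv :=
  fun x => if x = v then some t else β x

def updVE (ve : VEnv) (v : Var) (t : Time) (cl : Clos) : VEnv :=
  fun x s => if x = v ∧ s = t then some cl else ve x s

def emptyBE : BEnv := fun _ => none
def emptyVE : VEnv := fun _ _ => none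

/-- Concrete evaluation of user expressions (the function `A` of Fig. 2). -/
inductive EvUC (β : BEnv) (ve : VEnv) : UExp → UClos → Prop
  | lam (f : ULam) : EvUC β ve (.lam f) ⟨f, β⟩
  | var (v : UVar) (t : Time) (cl : UClos) :
      β (Sum.inl v) = some t → ve (Sum.inl v) t = some (.inl cl) →
      EvUC β ve (.var v) cl

/-- Concrete evaluation of continuation expressions. -/
inductive EvCC (β : BEnv) (ve : VEnv) : CExp → CClos → Prop
  | lam (f : CLam) : EvCC β ve (.lam f) (.clo f β)
  | var (k : CVar) (t : Time) (cl : CClos) :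
      β (Sum.inr k) = some t → ve (Sum.inr k) t = some (.inr cl) →
      EvCC β ve (.var k) cl

/-- Concrete states. -/
inductive CState : Type
  | eval (call : Call) (β : BEnv) (ve : VEnv) (t : Time)
  | applyU (proc : UClos) (d : UClos) (c : CClos) (ve : VEnv) (t : Time)
  | applyC (proc : CClos) (d : UClos) (ve : VEnv) (t : Time)

def veOf : CState → VEnv
  | .eval _ _ ve _ => ve
  | .applyU _ _ _ ve _ => ve
  | .applyC _ _ ve _ => ve

/-- The concrete transition relation (Fig. 2). -/
inductive CStep : CState → CState → Prop
  | uea : EvUC β ve f proc → EvUC β ve e d → EvCC β ve q c →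
      CStep (.eval (.u l f e q) β ve t) (.applyU proc d c ve (l :: t))
  | uae : CStep (.applyU ⟨.mk l u k body, β⟩ d c ve t)
      (.eval body (updB (updB β (Sum.inl u) t) (Sum.inr k) t)
        (updVE (updVE ve (Sum.inl u) t (.inl d)) (Sum.inr k) t (.inr c)) t)
  | cea : EvCC β ve q proc → EvUC β ve e d →
      CStep (.eval (.c g q e) β ve t) (.applyC proc d ve (g :: t))
  | cae : CStep (.applyC (.clo (.mk g u body) β) d ve t)
      (.eval body (updB β (Sum.inl u) t) (updVE ve (Sum.inl u) t (.inl d)) t)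

/-- Initial concrete state of program `pr` on input `inp`. -/
def initC (pr inp : ULam) : CState :=
  .applyU ⟨pr, emptyBE⟩ ⟨inp, emptyBE⟩ .halt emptyVE []

/-- Domain of a binding environment. -/
def domB (β : BEnv) : Set Var := {v | β v ≠ none}

/-! ## Abstract semantics (Fig. 4) -/

/-- Abstract user values: sets of user lambdas. -/
abbrev D := Set ULam

/-- Abstract continuations: a continuation lambda or halt. -/
inductive CAbs : Type
  | clam (f : CLam)
  | halt

/-- A frame maps user variables to abstract user values and continuation
variables to abstract continuations. -/
structure Frame where
  u : UVar → Option D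
  k : CVar → Option CAbs

abbrev Stack := List Frame
abbrev Heap := UVar → Option D

def Frame.updU (tf : Frame) (v : UVar) (d : D) : Frame :=
  ⟨fun x => if x = v then some d else tf.u x, tf.k⟩

def mkFrame (u : UVar) (d : D) (k : CVar) (c : CAbs) : Frame :=
  ⟨fun x => if x = u then some d else none, fun x => if x = k then some c else none⟩

/-- Heap join `h ⊔ [v ↦ d]`. -/
def hjoin (h : Heap) (v : UVar) (d : D) : Heap :=
  fun x => if x = v then some (d ∪ (h v).getD ∅) else h x

/-- Abstract states. -/
inductive AState : Type
  | eval (call : Call) (st : Stack) (h : Heap)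
  | applyU (f : ULam) (d : D) (c : CAbs) (st : Stack) (h : Heap)
  | applyC (c : CAbs) (d : D) (st : Stack) (h : Heap)

instance : Inhabited AState := ⟨.applyC .halt ∅ [] (fun _ => none)⟩

def stackOf : AState → Stack
  | .eval _ st _ => st
  | .applyU _ _ _ st _ => st
  | .applyC _ _ st _ => st

def setStack : AState → Stack → AState
  | .eval c _ h, st => .eval c st h
  | .applyU f d cc _ h, st => .applyU f d cc st h
  | .applyC cc d _ h, st => .applyC cc d st h

/-- Abstract evaluation of a user expression at call site `ψ`:
lambdas evaluate to singletons, stack references are looked up in the top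
frame and heap references in the heap. -/
inductive AEvalU (pr : ULam) : UExp → Lab → Stack → Heap → D → Prop
  | lam (f : ULam) (ψ : Lab) (st : Stack) (h : Heap) :
      AEvalU pr (.lam f) ψ st h {f}
  | stk (v : UVar) (ψ : Lab) (tf : Frame) (st : Stack) (h : Heap) (d : D) :
      Sum.inl v ∈ LV pr ψ → tf.u v = some d →
      AEvalU pr (.var v) ψ (tf :: st) h d
  | hp (v : UVar) (ψ : Lab) (st : Stack) (h : Heap) (d : D) :
      Sum.inl v ∉ LV pr ψ → h v = some d →
      AEvalU pr (.var v) ψ st h d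

/-- The abstract transition relation of CFA2 (Fig. 4). -/
inductive AStep (pr : ULam) : AState → AState → Prop
  | uea_tail :
      AEvalU pr f l (tf :: st) h df → ulam ∈ df →
      AEvalU pr e l (tf :: st) h d →
      tf.k kv = some c →
      AStep pr (.eval (.u l f e (.var kv)) (tf :: st) h) (.applyU ulam d c st h)
  | uea_flam :
      AEvalU pr e l st h d →
      AStep pr (.eval (.u l (.lam ulam) e (.lam cl)) st h)
               (.applyU ulam d (.clam cl) st h)
  | uea_fheap :
      Sum.inl fv ∉ LV pr l → h fv = some df → ulam ∈ df →
      AEvalU pr e l st h d →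
      AStep pr (.eval (.u l (.var fv) e (.lam cl)) st h)
               (.applyU ulam d (.clam cl) st h)
  | uea_fstk :
      Sum.inl fv ∈ LV pr l → tf.u fv = some df → ulam ∈ df →
      AEvalU pr e l (tf :: st) h d →
      AStep pr (.eval (.u l (.var fv) e (.lam cl)) (tf :: st) h)
               (.applyU ulam d (.clam cl) (Frame.updU tf fv {ulam} :: st) h)
  | uae_h :
      HVar pr u →
      AStep pr (.applyU (.mk l u k body) d c st h)
               (.eval body (mkFrame u d k c :: st) (hjoin h u d))
  | uae_s :
      ¬ HVar pr u →
      AStep pr (.applyU (.mk l u k body) d c st h)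
               (.eval body (mkFrame u d k c :: st) h)
  | cea_var :
      tf.k kv = some c → AEvalU pr e g (tf :: st) h d →
      AStep pr (.eval (.c g (.var kv) e) (tf :: st) h) (.applyC c d st h)
  | cea_lam :
      AEvalU pr e g st h d →
      AStep pr (.eval (.c g (.lam cl) e) st h) (.applyC (.clam cl) d st h)
  | cae_h :
      HVar pr u →
      AStep pr (.applyC (.clam (.mk g u body)) d (tf :: st) h)
               (.eval body (Frame.updU tf u d :: st) (hjoin h u d))
  | cae_s :
      ¬ HVar pr u →
      AStep pr (.applyC (.clam (.mk g u body)) d (tf :: st) h)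
               (.eval body (Frame.updU tf u d :: st) h)

/-! ### Classification of abstract states -/

def IsEntry : AState → Prop
  | .applyU _ _ _ _ _ => True
  | _ => False
def IsExitCEval : AState → Prop
  | .eval (.c _ (.var _) _) _ _ => True
  | _ => False
def IsTailCall : AState → Prop
  | .eval (.u _ _ _ (.var _)) _ _ => True
  | _ => False
def IsCall : AState → Prop
  | .eval (.u _ _ _ (.lam _)) _ _ => True
  | _ => False
def IsFinal : AState → Prop
  | .applyC .halt _ [] _ => True
  | _ => False

/-- Domain of a frame. -/
def domFrame (tf : Frame) : Set Var :=
  {v | ∃ u, v = Sum.inl u ∧ tf.u u ≠ none} ∪ {v | ∃ k, v = Sum.inr k ∧ tf.k k ≠ none}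

/-! ### The order ⊑ on abstract states (Fig. 5) -/

def FrameLE (f1 f2 : Frame) : Prop :=
  (∀ v d, f1.u v = some d → ∃ d', f2.u v = some d' ∧ d ⊆ d') ∧
  (∀ kv c, f1.k kv = some c → f2.k kv = some c)

def StackLE : Stack → Stack → Prop
  | [], [] => True
  | f1 :: s1, f2 :: s2 => FrameLE f1 f2 ∧ StackLE s1 s2
  | _, _ => False

def HeapLE (h1 h2 : Heap) : Prop :=
  ∀ v d, h1 v = some d → ∃ d', h2 v = some d' ∧ d ⊆ d'

def AStateLE : AState → AState → Prop
  | .eval c1 s1 h1, .eval c2 s2 h2 => c1 = c2 ∧ StackLE s1 s2 ∧ HeapLE h1 h2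
  | .applyU f1 d1 c1 s1 h1, .applyU f2 d2 c2 s2 h2 =>
      f1 = f2 ∧ d1 ⊆ d2 ∧ c1 = c2 ∧ StackLE s1 s2 ∧ HeapLE h1 h2
  | .applyC c1 d1 s1 h1, .applyC c2 d2 s2 h2 =>
      c1 = c2 ∧ d1 ⊆ d2 ∧ StackLE s1 s2 ∧ HeapLE h1 h2
  | _, _ => False

/-! ## Abstraction map |·|_ca from concrete to abstract states (Fig. 6) -/

def absU (cl : UClos) : D := {cl.lam}

def absC : CClos → CAbs
  | .clo f _ => .clam f
  | .halt => .halt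

open Classical in
/-- Abstraction of a variable environment: keep only heap variables, joining
over all times. -/
noncomputable def absVE (pr : ULam) (ve : VEnv) : Heap := fun v =>
  if HVar pr v then
    some {ul | ∃ t β', ve (Sum.inl v) t = some (.inl ⟨ul, β'⟩)}
  else none

open Classical in
/-- The user-variable part of the frame built by `toStack` for the variable
set `vs`: each user variable of `vs` in the domain of `β` is mapped to the
abstraction of its concrete value. -/
noncomputable def absEntryU (vs : Set Var) (β : BEnv) (ve : VEnv) : UVar → Option D :=
  fun v =>
    if Sum.inl v ∈ vs then
      (β (Sum.inl v)).bind fun t =>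
        (ve (Sum.inl v) t).bind fun cl =>
          match cl with
          | .inl ucl => some {ucl.lam}
          | .inr _ => none
    else none

/-- `ToStack pr ve vs β st`: `st` is the stack reconstructed from `β` and `ve`
for the variable set `vs` (the relation `toStack` of Fig. 6). -/
inductive ToStack (pr : ULam) (ve : VEnv) : Set Var → BEnv → Stack → Prop
  | halt (vs : Set Var) (β : BEnv) (kv : CVar) (t : Time) :
      Sum.inr kv ∈ vs →
      β (Sum.inr kv) = some t →
      ve (Sum.inr kv) t = some (.inr .halt) →
      ToStack pr ve vs β
        [⟨absEntryU vs β ve, fun x => if x = kv then some .halt else none⟩]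
  | cons (vs : Set Var) (β β' : BEnv) (kv : CVar) (t : Time) (g : Lab)
      (u : UVar) (body : Call) (st : Stack) :
      Sum.inr kv ∈ vs →
      β (Sum.inr kv) = some t →
      ve (Sum.inr kv) t = some (.inr (.clo (.mk g u body) β')) →
      ToStack pr ve (LV pr g) β' st →
      ToStack pr ve vs β
        (⟨absEntryU vs β ve,
          fun x => if x = kv then some (.clam (.mk g u body)) else none⟩ :: st)

/-- `CA pr ς ς̂`: `ς̂` is the abstraction `|ς|_ca` of the concrete state `ς`. -/
inductive CA (pr : ULam) : CState → AState → Prop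
  | eval (call : Call) (β : BEnv) (ve : VEnv) (t : Time) (st : Stack) :
      ToStack pr ve (LV pr (Call.lab call)) β st →
      CA pr (.eval call β ve t) (.eval call st (absVE pr ve))
  | applyU_halt (f : ULam) (β : BEnv) (d : UClos) (ve : VEnv) (t : Time) :
      CA pr (.applyU ⟨f, β⟩ d .halt ve t)
            (.applyU f (absU d) .halt [] (absVE pr ve))
  | applyU_clo (f : ULam) (β β' : BEnv) (d : UClos) (g : Lab) (u : UVar)
      (body : Call) (ve : VEnv) (t : Time) (st : Stack) :
      ToStack pr ve (LV pr g) β' st →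
      CA pr (.applyU ⟨f, β⟩ d (.clo (.mk g u body) β') ve t)
            (.applyU f (absU d) (.clam (.mk g u body)) st (absVE pr ve))
  | applyC_halt (d : UClos) (ve : VEnv) (t : Time) :
      CA pr (.applyC .halt d ve t) (.applyC .halt (absU d) [] (absVE pr ve))
  | applyC_clo (g : Lab) (u : UVar) (body : Call) (β : BEnv) (d : UClos)
      (ve : VEnv) (t : Time) (st : Stack) :
      ToStack pr ve (LV pr g) β st →
      CA pr (.applyC (.clo (.mk g u body) β) d ve t)
            (.applyC (.clam (.mk g u body)) (absU d) st (absVE pr ve))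

/-! ## Paths and push monotonicity -/

/-- `PushMono ste p`: every transition in `p` whose source has stack exactly
`ste` only pushes — it neither pops nor modifies the top frame. -/
def PushMono (ste : Stack) (p : List AState) : Prop :=
  ∀ i, i + 1 < p.length →
    stackOf (p.getD i default) = ste →
    ∃ ext, stackOf (p.getD (i + 1) default) = ext ++ ste

/-! ## Corresponding entries `CE` and `CE*` -/

mutual
  /-- `CE p j i`: the state at position `j` is the corresponding entry of the
  state at position `i` in path `p`. -/
  inductive CE (p : List AState) : ℕ → ℕ → Prop
    | entry (i : ℕ) :
        i < p.length → IsEntry (p.getD i default) → CE p i i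
    | inner (j i : ℕ) :
        i < p.length → 0 < i → ¬ IsEntry (p.getD i default) →
        ¬ IsExitCEval (p.getD (i - 1) default) →
        CE p j (i - 1) → CE p j i
    | callret (j m i : ℕ) :
        i < p.length → 0 < i → ¬ IsEntry (p.getD i default) →
        j < m → m + 3 ≤ i →
        IsCall (p.getD m default) → IsExitCEval (p.getD (i - 1) default) →
        CE p j m → CEstar p (m + 1) (i - 1) → CE p j i

  /-- `CEstar p j i`: the state at position `j` belongs to `CE*` of the state
  at position `i` in path `p`. -/
  inductive CEstar (p : List AState) : ℕ → ℕ → Prop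
    | base (j i : ℕ) : CE p j i → CEstar p j i
    | tail (j m i : ℕ) :
        m + 1 ≤ i → IsTailCall (p.getD m default) →
        IsEntry (p.getD (m + 1) default) → CE p (m + 1) i →
        CEstar p j m → CEstar p j i
end

/-! ## Local semantics (Fig. 7) -/

abbrev LFrame := UVar → Option D

/-- Local states: a single frame of user bindings instead of a stack. -/
inductive LState : Type
  | eval (call : Call) (tf : LFrame) (h : Heap)
  | applyU (f : ULam) (d : D) (h : Heap)
  | applyC (c : CAbs) (d : D) (tf : LFrame) (h : Heap)

instance : Inhabited LState := ⟨.applyC .halt ∅ (fun _ => none) (fun _ => none)⟩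

def topU : Stack → LFrame
  | [] => fun _ => none
  | tf :: _ => tf.u

/-- The map `|·|_al` from abstract to local states. -/
def toLocal : AState → LState
  | .eval call st h => .eval call (topU st) h
  | .applyU f d _ _ h => .applyU f d h
  | .applyC c d st h => .applyC c d (topU st) h

def updL (tf : LFrame) (v : UVar) (d : D) : LFrame :=
  fun x => if x = v then some d else tf x

/-- Local abstract evaluation of user expressions. -/
inductive LEvalU (pr : ULam) : UExp → Lab → LFrame → Heap → D → Prop
  | lam (f : ULam) (ψ : Lab) (tf : LFrame) (h : Heap) :
      LEvalU pr (.lam f) ψ tf h {f}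
  | stk (v : UVar) (ψ : Lab) (tf : LFrame) (h : Heap) (d : D) :
      Sum.inl v ∈ LV pr ψ → tf v = some d → LEvalU pr (.var v) ψ tf h d
  | hp (v : UVar) (ψ : Lab) (tf : LFrame) (h : Heap) (d : D) :
      Sum.inl v ∉ LV pr ψ → h v = some d → LEvalU pr (.var v) ψ tf h d

/-- The local transition relation `≈>` (Fig. 7).  A local `CEval` whose
operator is a variable has no successor. -/
inductive LStep (pr : ULam) : LState → LState → Prop
  | uea :
      LEvalU pr f l tf h df → ulam ∈ df → LEvalU pr e l tf h d →
      LStep pr (.eval (.u l f e q) tf h) (.applyU ulam d h)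
  | uae_h :
      HVar pr u →
      LStep pr (.applyU (.mk l u k body) d h)
               (.eval body (updL (fun _ => none) u d) (hjoin h u d))
  | uae_s :
      ¬ HVar pr u →
      LStep pr (.applyU (.mk l u k body) d h)
               (.eval body (updL (fun _ => none) u d) h)
  | cea :
      LEvalU pr e g tf h d →
      LStep pr (.eval (.c g (.lam cl) e) tf h) (.applyC (.clam cl) d tf h)
  | cae_h :
      HVar pr u →
      LStep pr (.applyC (.clam (.mk g u body)) d tf h)
               (.eval body (updL tf u d) (hjoin h u d))
  | cae_s :
      ¬ HVar pr u →
      LStep pr (.applyC (.clam (.mk g u body)) d tf h)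
               (.eval body (updL tf u d) h)

/-! ### Classification of local states -/

def LIsEntry : LState → Prop
  | .applyU _ _ _ => True
  | _ => False
def LIsCApply : LState → Prop
  | .applyC _ _ _ _ => True
  | _ => False
def LIsInnerCEval : LState → Prop
  | .eval (.c _ (.lam _) _) _ _ => True
  | _ => False
def LIsExitCEval : LState → Prop
  | .eval (.c _ (.var _) _) _ _ => True
  | _ => False
def LIsCall : LState → Prop
  | .eval (.u _ _ _ (.lam _)) _ _ => True
  | _ => False
def LIsTailCall : LState → Prop
  | .eval (.u _ _ _ (.var _)) _ _ => True
  | _ => False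

/-! ## The summarization algorithm (Fig. 8) -/

/-- `UpdateRes pr ς̃1 ς̃2 ς̃3 ς̃4 ς̃`: `ς̃` is the return state computed by
`Update(ς̃1, ς̃2, ς̃3, ς̃4)` (lines 26–33 of Fig. 8): `ς̃1` is an entry, `ς̃2`
a call in the same procedure, `ς̃3` the entry of the callee, `ς̃4` an
Exit-CEval; the return value is the value of the expression passed to the
continuation, and the caller's frame is restored (with stack filtering when
the operator is a stack reference). -/
inductive UpdateRes (pr : ULam) : LState → LState → LState → LState → LState → Prop
  | filter :
      Sum.inl fv ∈ LV pr l2 →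
      LEvalU pr e4 g4 tf4 h4 d →
      UpdateRes pr
        (.applyU (.mk l1 u1 k1 c1) d1 h1)
        (.eval (.u l2 (.var fv) e2 (.lam (.mk g2 u2 c2))) tf2 h2)
        (.applyU (.mk l3 u3 k3 c3) d3 h2)
        (.eval (.c g4 (.var k4) e4) tf4 h4)
        (.applyC (.clam (.mk g2 u2 c2)) d (updL tf2 fv {ULam.mk l3 u3 k3 c3}) h4)
  | heapref :
      Sum.inl fv ∉ LV pr l2 →
      LEvalU pr e4 g4 tf4 h4 d →
      UpdateRes pr
        (.applyU (.mk l1 u1 k1 c1) d1 h1)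
        (.eval (.u l2 (.var fv) e2 (.lam (.mk g2 u2 c2))) tf2 h2)
        (.applyU (.mk l3 u3 k3 c3) d3 h2)
        (.eval (.c g4 (.var k4) e4) tf4 h4)
        (.applyC (.clam (.mk g2 u2 c2)) d tf2 h4)
  | flam :
      LEvalU pr e4 g4 tf4 h4 d →
      UpdateRes pr
        (.applyU (.mk l1 u1 k1 c1) d1 h1)
        (.eval (.u l2 (.lam fl) e2 (.lam (.mk g2 u2 c2))) tf2 h2)
        (.applyU (.mk l3 u3 k3 c3) d3 h2)
        (.eval (.c g4 (.var k4) e4) tf4 h4)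
        (.applyC (.clam (.mk g2 u2 c2)) d tf2 h4)

/-- A configuration of the summarization algorithm. -/
structure Config where
  Seen : Set (LState × LState)
  W : Set (LState × LState)
  Summary : Set (LState × LState)
  Callers : Set (LState × LState × LState)
  TCallers : Set (LState × LState × LState)
  Final : Set LState

/-- `Propagate`: insert a set of edges into `Seen`, and into the workset
unless already seen. -/
def propagate (c : Config) (W0 : Set (LState × LState))
    (P : Set (LState × LState)) : Config :=
  { c with Seen := c.Seen ∪ P, W := W0 ∪ (P \ c.Seen) }

open Classical in
/-- One iteration of the summarization algorithm: process the edge `e`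
removed from the workset (lines 5–24 of Fig. 8). -/
noncomputable def processEdge (pr : ULam) (ι : LState) (c : Config)
    (e : LState × LState) : Config :=
  let W0 := c.W \ {e}
  match e.2 with
  | .applyU _ _ _ =>
      propagate c W0 {q | ∃ s3, LStep pr e.2 s3 ∧ q = (e.1, s3)}
  | .applyC _ _ _ _ =>
      propagate c W0 {q | ∃ s3, LStep pr e.2 s3 ∧ q = (e.1, s3)}
  | .eval (.c _ (.lam _) _) _ _ =>
      propagate c W0 {q | ∃ s3, LStep pr e.2 s3 ∧ q = (e.1, s3)}
  | .eval (.c g (.var _) ex) tf h =>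
      if e.1 = ι then
        { c with
          W := W0,
          Final := c.Final ∪
            {s | ∃ d, LEvalU pr ex g tf h d ∧
                 s = .applyC .halt d (fun _ => none) h} }
      else
        { propagate c W0
            ({q | ∃ s3 s4 r, (s3, s4, e.1) ∈ c.Callers ∧
                  UpdateRes pr s3 s4 e.1 e.2 r ∧ q = (s3, r)} ∪
             {q | ∃ s3 s4, (s3, s4, e.1) ∈ c.TCallers ∧ q = (s3, e.2)})
          with Summary := c.Summary ∪ {e} }
  | .eval (.u _ _ _ (.lam _)) _ _ =>
      { propagate c W0
          ({q | ∃ s3, LStep pr e.2 s3 ∧ q = (s3, s3)} ∪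
           {q | ∃ s3 s4 r, LStep pr e.2 s3 ∧ (s3, s4) ∈ c.Summary ∧
                UpdateRes pr e.1 e.2 s3 s4 r ∧ q = (e.1, r)})
        with Callers := c.Callers ∪ {tr | ∃ s3, LStep pr e.2 s3 ∧ tr = (e.1, e.2, s3)} }
  | .eval (.u _ _ _ (.var _)) _ _ =>
      { propagate c W0
          ({q | ∃ s3, LStep pr e.2 s3 ∧ q = (s3, s3)} ∪
           {q | ∃ s3 s4, LStep pr e.2 s3 ∧ (s3, s4) ∈ c.Summary ∧ q = (e.1, s4)})
        with TCallers := c.TCallers ∪ {tr | ∃ s3, LStep pr e.2 s3 ∧ tr = (e.1, e.2, s3)} }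

/-- One step of the algorithm: pick any edge in the workset and process it. -/
inductive AlgoStep (pr : ULam) (ι : LState) : Config → Config → Prop
  | step (c : Config) (e : LState × LState) :
      e ∈ c.W → AlgoStep pr ι c (processEdge pr ι c e)

/-- The initial configuration (lines 1–2 of Fig. 8). -/
def initConfig (ι : LState) : Config := ⟨{(ι, ι)}, {(ι, ι)}, ∅, ∅, ∅, ∅⟩

/-- The initial abstract state of a program `pr` on input `inp`. -/
def initA (pr inp : ULam) : AState := .applyU pr {inp} .halt [] (fun _ => none)

/-! ## STATEMENT 11: Soundness of summarization -/


/-! ### The invariant of the algorithm -/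

/-- The edges in `S` have been processed with respect to the configuration `c`. -/
structure Processed (pr : ULam) (ι : LState) (c : Config) (S : Set (LState × LState)) : Prop where
  step : ∀ a b s, (a, b) ∈ S → LIsEntry b ∨ LIsCApply b ∨ LIsInnerCEval b →
    LStep pr b s → (a, s) ∈ c.Seen
  exit_final : ∀ g k ex tf h d, (ι, LState.eval (.c g (.var k) ex) tf h) ∈ S →
    LEvalU pr ex g tf h d → .applyC .halt d (fun _ => none) h ∈ c.Final
  exit_summary : ∀ a b, (a, b) ∈ S → LIsExitCEval b → a ≠ ι → (a, b) ∈ c.Summary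
  call_entry : ∀ a b s, (a, b) ∈ S → LIsCall b ∨ LIsTailCall b → LStep pr b s → (s, s) ∈ c.Seen
  call_callers : ∀ a b s, (a, b) ∈ S → LIsCall b → LStep pr b s → (a, b, s) ∈ c.Callers
  tail_callers : ∀ a b s, (a, b) ∈ S → LIsTailCall b → LStep pr b s → (a, b, s) ∈ c.TCallers

/-- The invariant of the summarization algorithm. -/
structure AlgoInv (pr : ULam) (ι : LState) (c : Config) : Prop where
  init_seen : (ι, ι) ∈ c.Seen
  work_seen : c.W ⊆ c.Seen
  processed : Processed pr ι c (c.Seen \ c.W)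
  update : ∀ s1 s2 s3 s4 r, (s1, s2, s3) ∈ c.Callers → (s3, s4) ∈ c.Summary →
    UpdateRes pr s1 s2 s3 s4 r → (s1, r) ∈ c.Seen
  tail_update : ∀ s1 s2 s3 s4, (s1, s2, s3) ∈ c.TCallers → (s3, s4) ∈ c.Summary →
    (s1, s4) ∈ c.Seen

theorem AlgoInv.initConfig (pr : ULam) (ι : LState) : AlgoInv pr ι (initConfig ι) where
  init_seen := rfl
  work_seen := fun _ h => h
  processed := by
    have h0 : (CFA2.initConfig ι).Seen \ (CFA2.initConfig ι).W = ∅ := by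
      simp [CFA2.initConfig]
    rw [h0]
    constructor <;> simp
  update := by simp [CFA2.initConfig]
  tail_update := by simp [CFA2.initConfig]

/-- Processed edges stay processed when the configuration grows. -/
theorem Processed.mono {pr : ULam} {ι : LState} {c c' : Config} {S T : Set (LState × LState)}
    (hp : Processed pr ι c S) (hT : T ⊆ S) (h1 : c.Seen ⊆ c'.Seen)
    (h2 : c.Summary ⊆ c'.Summary) (h3 : c.Callers ⊆ c'.Callers)
    (h4 : c.TCallers ⊆ c'.TCallers) (h5 : c.Final ⊆ c'.Final) : Processed pr ι c' T where
  step a b s h hb hs := h1 (hp.step a b s (hT h) hb hs)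
  exit_final g k ex tf h d hm he := h5 (hp.exit_final g k ex tf h d (hT hm) he)
  exit_summary a b h hb hne := h2 (hp.exit_summary a b (hT h) hb hne)
  call_entry a b s h hb hs := h1 (hp.call_entry a b s (hT h) hb hs)
  call_callers a b s h hb hs := h3 (hp.call_callers a b s (hT h) hb hs)
  tail_callers a b s h hb hs := h4 (hp.tail_callers a b s (hT h) hb hs)

theorem Processed.union {pr : ULam} {ι : LState} {c : Config} {S T : Set (LState × LState)}
    (hS : Processed pr ι c S) (hT : Processed pr ι c T) : Processed pr ι c (S ∪ T) where
  step a b s h hb hs := h.elim (fun h => hS.step a b s h hb hs) fun h => hT.step a b s h hb hs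
  exit_final g k ex tf h d hm he :=
    hm.elim (fun hm => hS.exit_final g k ex tf h d hm he) fun hm => hT.exit_final g k ex tf h d hm he
  exit_summary a b h hb hne :=
    h.elim (fun h => hS.exit_summary a b h hb hne) fun h => hT.exit_summary a b h hb hne
  call_entry a b s h hb hs :=
    h.elim (fun h => hS.call_entry a b s h hb hs) fun h => hT.call_entry a b s h hb hs
  call_callers a b s h hb hs :=
    h.elim (fun h => hS.call_callers a b s h hb hs) fun h => hT.call_callers a b s h hb hs
  tail_callers a b s h hb hs :=
    h.elim (fun h => hS.tail_callers a b s h hb hs) fun h => hT.tail_callers a b s h hb hs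

/-- To re-establish the invariant after a step it suffices that the step enlarges every component,
updates the workset as `propagate` does, processes its edge and treats the new summaries
and callers. -/
theorem AlgoInv.of_step {pr : ULam} {ι : LState} {c c' : Config} {e : LState × LState}
    (hc : AlgoInv pr ι c) (P : Set (LState × LState))
    (hSeen : c'.Seen = c.Seen ∪ P) (hW : c'.W = c.W \ {e} ∪ P \ c.Seen)
    (h2 : c.Summary ⊆ c'.Summary) (h3 : c.Callers ⊆ c'.Callers)
    (h4 : c.TCallers ⊆ c'.TCallers) (h5 : c.Final ⊆ c'.Final)
    (hproc : Processed pr ι c' {e})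
    (hup : ∀ s1 s2 s3 s4 r, (s1, s2, s3) ∈ c'.Callers → (s3, s4) ∈ c'.Summary →
      ¬ ((s1, s2, s3) ∈ c.Callers ∧ (s3, s4) ∈ c.Summary) →
      UpdateRes pr s1 s2 s3 s4 r → (s1, r) ∈ P)
    (htup : ∀ s1 s2 s3 s4, (s1, s2, s3) ∈ c'.TCallers → (s3, s4) ∈ c'.Summary →
      ¬ ((s1, s2, s3) ∈ c.TCallers ∧ (s3, s4) ∈ c.Summary) → (s1, s4) ∈ P) :
    AlgoInv pr ι c' := by
  have h1 : c.Seen ⊆ c'.Seen := hSeen ▸ Set.subset_union_left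
  refine ⟨h1 hc.init_seen, ?_, ?_, ?_, ?_⟩
  · rw [hW, hSeen]
    rintro q (hq | hq)
    · exact Or.inl (hc.work_seen hq.1)
    · exact Or.inr hq.1
  · refine ((hc.processed.mono subset_rfl h1 h2 h3 h4 h5).union hproc).mono ?_ subset_rfl subset_rfl
      subset_rfl subset_rfl subset_rfl
    rw [hW, hSeen]
    rintro q ⟨hq | hq, hn⟩
    · by_cases hqe : q = e
      · exact Or.inr hqe
      · exact Or.inl ⟨hq, fun hw => hn (Or.inl ⟨hw, hqe⟩)⟩
    · by_cases hs : q ∈ c.Seen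
      · by_cases hqe : q = e
        · exact Or.inr hqe
        · exact Or.inl ⟨hs, fun hw => hn (Or.inl ⟨hw, hqe⟩)⟩
      · exact absurd (Or.inr ⟨hq, hs⟩) hn
  · intro s1 s2 s3 s4 r ha hb hr
    by_cases h : (s1, s2, s3) ∈ c.Callers ∧ (s3, s4) ∈ c.Summary
    · exact h1 (hc.update _ _ _ _ _ h.1 h.2 hr)
    · rw [hSeen]; exact Or.inr (hup _ _ _ _ _ ha hb h hr)
  · intro s1 s2 s3 s4 ha hb
    by_cases h : (s1, s2, s3) ∈ c.TCallers ∧ (s3, s4) ∈ c.Summary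
    · exact h1 (hc.tail_update _ _ _ _ h.1 h.2)
    · rw [hSeen]; exact Or.inr (htup _ _ _ _ ha hb h)

theorem AlgoInv.processEdge {pr : ULam} {ι : LState} {c : Config} {e : LState × LState}
    (hc : AlgoInv pr ι c) (he : e ∈ c.W) : AlgoInv pr ι (processEdge pr ι c e) := by
  obtain ⟨a, b⟩ := e
  rcases b with ⟨⟨l, f, ex, q | k⟩ | ⟨g, q | k, ex⟩, tf, h⟩ | ⟨f, d, h⟩ | ⟨cc, d, tf, h⟩
  · refine hc.of_step _ rfl rfl subset_rfl Set.subset_union_left subset_rfl subset_rfl ?_ ?_ ?_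
    · constructor <;> intros <;>
        simp_all [CFA2.processEdge, propagate, LIsEntry, LIsCApply, LIsInnerCEval,
          LIsExitCEval, LIsCall, LIsTailCall]
    · rintro s1 s2 s3 s4 r (ha | ⟨s, hs, ha⟩) hb hn hr
      · exact absurd ⟨ha, hb⟩ hn
      · cases ha
        exact Or.inr ⟨_, _, _, hs, hb, hr, rfl⟩
    · exact fun s1 s2 s3 s4 ha hb hn => absurd ⟨ha, hb⟩ hn
  · refine hc.of_step _ rfl rfl subset_rfl subset_rfl Set.subset_union_left subset_rfl ?_ ?_ ?_
    · constructor <;> intros <;>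
        simp_all [CFA2.processEdge, propagate, LIsEntry, LIsCApply, LIsInnerCEval,
          LIsExitCEval, LIsCall, LIsTailCall]
    · exact fun s1 s2 s3 s4 r ha hb hn _ => absurd ⟨ha, hb⟩ hn
    · rintro s1 s2 s3 s4 (ha | ⟨s, hs, ha⟩) hb hn
      · exact absurd ⟨ha, hb⟩ hn
      · cases ha
        exact Or.inr ⟨_, _, hs, hb, rfl⟩
  · refine hc.of_step _ rfl rfl subset_rfl subset_rfl subset_rfl subset_rfl ?_
      (fun s1 s2 s3 s4 r ha hb hn _ => absurd ⟨ha, hb⟩ hn)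
      (fun s1 s2 s3 s4 ha hb hn => absurd ⟨ha, hb⟩ hn)
    constructor <;> intros <;>
      simp_all [CFA2.processEdge, propagate, LIsEntry, LIsCApply, LIsInnerCEval, LIsExitCEval,
        LIsCall, LIsTailCall]
  · by_cases hι : a = ι
    · have hpe : CFA2.processEdge pr ι c (a, .eval (.c g (.var k) ex) tf h) =
          { c with
            W := c.W \ {(a, .eval (.c g (.var k) ex) tf h)},
            Final := c.Final ∪
              {s | ∃ d, LEvalU pr ex g tf h d ∧
                 s = .applyC .halt d (fun _ => none) h} } := by
        simp [CFA2.processEdge, hι]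
      rw [hpe]
      refine hc.of_step (e := (a, .eval (.c g (.var k) ex) tf h)) ∅ (by simp) (by simp)
        subset_rfl subset_rfl subset_rfl Set.subset_union_left ?_
        (fun s1 s2 s3 s4 r ha hb hn _ => absurd ⟨ha, hb⟩ hn)
        (fun s1 s2 s3 s4 ha hb hn => absurd ⟨ha, hb⟩ hn)
      constructor <;> intros <;>
        simp_all [LIsEntry, LIsCApply, LIsInnerCEval, LIsCall, LIsTailCall]
    · have hpe : CFA2.processEdge pr ι c (a, .eval (.c g (.var k) ex) tf h) =
          { propagate c (c.W \ {(a, .eval (.c g (.var k) ex) tf h)})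
            ({q | ∃ s3 s4 r, (s3, s4, a) ∈ c.Callers ∧
                  UpdateRes pr s3 s4 a (.eval (.c g (.var k) ex) tf h) r ∧ q = (s3, r)} ∪
             {q | ∃ s3 s4, (s3, s4, a) ∈ c.TCallers ∧ q = (s3, .eval (.c g (.var k) ex) tf h)})
            with Summary := c.Summary ∪ {(a, .eval (.c g (.var k) ex) tf h)} } := by
        simp [CFA2.processEdge, hι]
      rw [hpe]
      refine hc.of_step _ rfl rfl Set.subset_union_left subset_rfl subset_rfl subset_rfl ?_ ?_ ?_
      · constructor <;> intros <;>
          simp_all [propagate, LIsEntry, LIsCApply, LIsInnerCEval, LIsExitCEval, LIsCall,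
            LIsTailCall]
      · rintro s1 s2 s3 s4 r ha (hb | hb) hn hr
        · exact absurd ⟨ha, hb⟩ hn
        · cases hb
          exact Or.inl ⟨_, _, _, ha, hr, rfl⟩
      · rintro s1 s2 s3 s4 ha (hb | hb) hn
        · exact absurd ⟨ha, hb⟩ hn
        · cases hb
          exact Or.inr ⟨_, _, ha, rfl⟩
  all_goals
    refine hc.of_step _ rfl rfl subset_rfl subset_rfl subset_rfl subset_rfl ?_
      (fun s1 s2 s3 s4 r ha hb hn _ => absurd ⟨ha, hb⟩ hn)
      (fun s1 s2 s3 s4 ha hb hn => absurd ⟨ha, hb⟩ hn)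
    constructor <;> intros <;>
      simp_all [CFA2.processEdge, propagate, LIsEntry, LIsCApply, LIsInnerCEval, LIsExitCEval,
        LIsCall, LIsTailCall]

theorem AlgoInv.of_reachable {pr : ULam} {ι : LState} {c : Config}
    (h : Relation.ReflTransGen (AlgoStep pr ι) (CFA2.initConfig ι) c) : AlgoInv pr ι c := by
  induction h with
  | refl => exact .initConfig pr ι
  | tail _ hs ih => cases hs with | step e he => exact ih.processEdge he

/-! ### Abstract and local transitions -/

theorem AEvalU.toLocal {pr : ULam} {e : UExp} {l : Lab} {st : Stack} {h : Heap} {d : D}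
    (he : AEvalU pr e l st h d) : LEvalU pr e l (topU st) h d := by
  cases he with
  | lam => exact .lam ..
  | stk _ _ _ _ _ _ hv hd => exact .stk _ _ _ _ _ hv hd
  | hp _ _ _ _ _ hv hd => exact .hp _ _ _ _ _ hv hd

theorem AStep.toLocal {pr : ULam} {s s' : AState} (hs : AStep pr s s') (he : ¬ IsExitCEval s) :
    LStep pr (CFA2.toLocal s) (CFA2.toLocal s') := by
  cases hs with
  | uea_tail hf hu hd => exact .uea hf.toLocal hu hd.toLocal
  | uea_flam hd => exact .uea (.lam ..) rfl hd.toLocal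
  | uea_fheap hv hf hu hd => exact .uea (.hp _ _ _ _ _ hv hf) hu hd.toLocal
  | uea_fstk hv hf hu hd => exact .uea (.stk _ _ _ _ _ hv hf) hu hd.toLocal
  | uae_h hu => exact .uae_h hu
  | uae_s hu => exact .uae_s hu
  | cea_var => exact absurd trivial he
  | cea_lam hd => exact .cea hd.toLocal
  | cae_h hu => exact .cae_h hu
  | cae_s hu => exact .cae_s hu

theorem AStep.source_of_entry {pr : ULam} {s s' : AState} (hs : AStep pr s s') (h : IsEntry s') :
    IsCall s ∨ IsTailCall s := by
  cases hs <;> simp_all [IsEntry, IsCall, IsTailCall]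

theorem toLocal_isExitCEval {s : AState} (h : IsExitCEval s) : LIsExitCEval (toLocal s) := by
  rcases s with ⟨⟨l, f, ex, q | k⟩ | ⟨g, q | k, ex⟩, st, h⟩ | ⟨f, d, cc, st, h⟩ | ⟨cc, d, st, h⟩ <;>
    exact h

theorem toLocal_isCall {s : AState} (h : IsCall s) : LIsCall (toLocal s) := by
  rcases s with ⟨⟨l, f, ex, q | k⟩ | ⟨g, q | k, ex⟩, st, h⟩ | ⟨f, d, cc, st, h⟩ | ⟨cc, d, st, h⟩ <;>
    exact h

theorem toLocal_isTailCall {s : AState} (h : IsTailCall s) : LIsTailCall (toLocal s) := by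
  rcases s with ⟨⟨l, f, ex, q | k⟩ | ⟨g, q | k, ex⟩, st, h⟩ | ⟨f, d, cc, st, h⟩ | ⟨cc, d, st, h⟩ <;>
    exact h

theorem toLocal_isInner {s : AState} (h1 : ¬ IsExitCEval s) (h2 : ¬ IsCall s)
    (h3 : ¬ IsTailCall s) :
    LIsEntry (toLocal s) ∨ LIsCApply (toLocal s) ∨ LIsInnerCEval (toLocal s) := by
  rcases s with ⟨⟨l, f, ex, q | k⟩ | ⟨g, q | k, ex⟩, st, h⟩ | ⟨f, d, cc, st, h⟩ | ⟨cc, d, st, h⟩ <;>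
    simp_all [IsExitCEval, IsCall, IsTailCall, toLocal, LIsEntry, LIsCApply, LIsInnerCEval]

/-! ### States of one procedure activation -/

/-- `InProc c st s`: the state `s` is not an entry and its top frame is that of an activation
entered with continuation `c` and stack `st`. -/
def InProc (c : CAbs) (st : Stack) (s : AState) : Prop :=
  ¬ IsEntry s ∧ ∃ fr, (∀ kv c', fr.k kv = some c' → c' = c) ∧ stackOf s = fr :: st

theorem InProc.of_entry {pr : ULam} {f : ULam} {d : D} {c : CAbs} {st : Stack} {h : Heap}
    {s : AState} (hs : AStep pr (.applyU f d c st h) s) : InProc c st s := by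
  cases hs <;> refine ⟨id, _, ?_, rfl⟩ <;> simp +contextual [mkFrame, eq_comm]

theorem InProc.step {pr : ULam} {c : CAbs} {st : Stack} {s s' : AState} (hp : InProc c st s)
    (hs : AStep pr s s') (he : ¬ IsEntry s') (hx : ¬ IsExitCEval s) : InProc c st s' := by
  obtain ⟨hn, fr, hk, hst⟩ := hp
  refine ⟨he, ?_⟩
  cases hs <;> simp_all [IsEntry, IsExitCEval, stackOf, Frame.updU] <;> exact hk

theorem InProc.exit {pr : ULam} {c : CAbs} {st : Stack} {s s' : AState} (hp : InProc c st s)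
    (hs : AStep pr s s') (hx : IsExitCEval s) : ∃ d h, s' = .applyC c d st h := by
  obtain ⟨hn, fr, hk, hst⟩ := hp
  cases hs with
  | cea_var hc =>
    cases hst
    exact ⟨_, _, by rw [hk _ _ hc]⟩
  | _ => exact hx.elim

theorem InProc.tailCall {pr : ULam} {c : CAbs} {st : Stack} {s s' : AState} (hp : InProc c st s)
    (hs : AStep pr s s') (hx : IsTailCall s) : ∃ f d h, s' = .applyU f d c st h := by
  obtain ⟨hn, fr, hk, hst⟩ := hp
  cases hs with
  | uea_tail _ _ _ hc =>
    cases hst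
    exact ⟨_, _, _, by rw [hk _ _ hc]⟩
  | _ => exact hx.elim

theorem InProc.call {pr : ULam} {c : CAbs} {st : Stack} {s s' : AState} (hp : InProc c st s)
    (hs : AStep pr s s') (hx : IsCall s) :
    ∃ f d cl fr h, s' = .applyU f d (.clam cl) (fr :: st) h ∧
      ∀ kv c', fr.k kv = some c' → c' = c := by
  obtain ⟨hn, fr, hk, hst⟩ := hp
  cases hs with
  | uea_flam => cases hst; exact ⟨_, _, _, _, _, rfl, hk⟩
  | uea_fheap => cases hst; exact ⟨_, _, _, _, _, rfl, hk⟩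
  | uea_fstk => cases hst; exact ⟨_, _, _, _, _, rfl, hk⟩
  | _ => exact hx.elim

/-- The state after a return is the one computed by `Update`. -/
theorem UpdateRes.of_return {pr : ULam} {f : ULam} {d : D} {c c' : CAbs} {st st' : Stack}
    {h h' : Heap} {f' : ULam} {d' : D} {sc sx sr : AState} (hx : IsExitCEval sx)
    (hcall : AStep pr sc (.applyU f' d' c' st' h')) (hc : IsCall sc)
    (hret : AStep pr sx sr) (hin : InProc c' st' sx) :
    UpdateRes pr (toLocal (.applyU f d c st h)) (toLocal sc)
      (toLocal (.applyU f' d' c' st' h')) (toLocal sx) (toLocal sr) := by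
  obtain ⟨_, fr, hk, hst⟩ := hin
  obtain ⟨l1, u1, k1, b1⟩ := f
  obtain ⟨l3, u3, k3, b3⟩ := f'
  cases hret with
  | cea_var hcc hd =>
    cases hst
    cases hk _ _ hcc
    cases hcall with
    | uea_tail => exact hc.elim
    | @uea_flam _ _ _ _ _ _ cl =>
      cases cl
      exact .flam hd.toLocal
    | @uea_fheap _ _ _ _ _ _ _ _ cl hv =>
      cases cl
      exact .heapref hv hd.toLocal
    | @uea_fstk _ _ _ _ _ _ _ _ _ cl hv =>
      cases cl
      exact .filter hv hd.toLocal
  | _ => exact hx.elim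

/-! ### Corresponding entries along a path -/

/-- Consecutive states of `p` are related by the transition relation. -/
def IsPath (pr : ULam) (p : List AState) : Prop :=
  ∀ i, i + 1 < p.length → AStep pr (p.getD i default) (p.getD (i + 1) default)

/-- `Owns p j i`: position `j` holds an entry, and position `i` is `j` itself or belongs to an
activation with the same continuation and stack. -/
def Owns (p : List AState) (j i : ℕ) : Prop :=
  j ≤ i ∧ i < p.length ∧ ∃ f d c st h, p.getD j default = .applyU f d c st h ∧
    (i = j ∨ InProc c st (p.getD i default))

theorem Owns.inProc {p : List AState} {j i : ℕ} (h : Owns p j i)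
    (hi : ¬ IsEntry (p.getD i default)) :
    ∃ f d c st h, p.getD j default = .applyU f d c st h ∧ InProc c st (p.getD i default) := by
  obtain ⟨_, _, f, d, c, st, h, hj, rfl | hp⟩ := h
  · rw [hj] at hi; exact absurd trivial hi
  · exact ⟨f, d, c, st, h, hj, hp⟩

theorem not_isEntry_of_isCall {s : AState} (h : IsCall s) : ¬ IsEntry s := by
  cases s <;> simp_all [IsCall, IsEntry]

theorem not_isEntry_of_isTailCall {s : AState} (h : IsTailCall s) : ¬ IsEntry s := by
  cases s <;> simp_all [IsTailCall, IsEntry]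

theorem not_isEntry_of_isExitCEval {s : AState} (h : IsExitCEval s) : ¬ IsEntry s := by
  cases s <;> simp_all [IsExitCEval, IsEntry]

theorem Owns.entry {p : List AState} {i : ℕ} (hi : i < p.length)
    (he : IsEntry (p.getD i default)) : Owns p i i := by
  refine ⟨le_rfl, hi, ?_⟩
  cases hs : p.getD i default with
  | applyU f d c st h => exact ⟨f, d, c, st, h, rfl, .inl rfl⟩
  | _ => rw [hs] at he; exact he.elim

theorem Owns.inner {pr : ULam} {p : List AState} (hp : IsPath pr p) {j i : ℕ}
    (hi : i + 1 < p.length) (he : ¬ IsEntry (p.getD (i + 1) default))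
    (hx : ¬ IsExitCEval (p.getD i default)) (h : Owns p j i) : Owns p j (i + 1) := by
  obtain ⟨hji, _, f, d, c, st, h, hj, rfl | hq⟩ := h
  · exact ⟨by omega, hi, f, d, c, st, h, hj, .inr (.of_entry (hj ▸ hp _ hi))⟩
  · exact ⟨by omega, hi, f, d, c, st, h, hj, .inr (hq.step (hp _ hi) he hx)⟩

theorem Owns.ret {pr : ULam} {p : List AState} (hp : IsPath pr p) {j m i : ℕ}
    (hi : i + 1 < p.length) (he : ¬ IsEntry (p.getD (i + 1) default)) (hmi : m + 1 ≤ i)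
    (hc : IsCall (p.getD m default)) (hx : IsExitCEval (p.getD i default))
    (h : Owns p j m) (h' : Owns p (m + 1) i) : Owns p j (i + 1) := by
  obtain ⟨f, d, c, st, hh, hj, hq⟩ := h.inProc (not_isEntry_of_isCall hc)
  obtain ⟨f', d', c', st', hh', hj', hq'⟩ := h'.inProc (not_isEntry_of_isExitCEval hx)
  obtain ⟨_, _, cl, fr, _, hm, hfr⟩ := hq.call (hp m (by omega)) hc
  obtain ⟨_, _, hret⟩ := hq'.exit (hp i hi) hx
  rw [hm] at hj'
  cases hj'
  refine ⟨by have := h.1; omega, hi, f, d, c, st, hh, hj, .inr ⟨he, fr, hfr, ?_⟩⟩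
  rw [hret]; rfl

theorem Owns.tail {pr : ULam} {p : List AState} (hp : IsPath pr p) {j m i : ℕ}
    (ht : IsTailCall (p.getD m default)) (h' : Owns p (m + 1) i) (h : Owns p j m)
    (hi : ¬ IsEntry (p.getD i default)) :
    Owns p j i := by
  obtain ⟨f, d, c, st, hh, hj, hq⟩ := h.inProc (not_isEntry_of_isTailCall ht)
  obtain ⟨f', d', c', st', hh', hj', hq'⟩ := h'.inProc hi
  have hl := h'.1
  have hl' := h'.2.1
  obtain ⟨_, _, _, hm⟩ := hq.tailCall (hp m (by omega)) ht
  rw [hm] at hj'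
  cases hj'
  exact ⟨by have := h.1; omega, hl', f, d, c, st, hh, hj, .inr hq'⟩

theorem CE.owns {pr : ULam} {p : List AState} (hp : IsPath pr p) {j i : ℕ} (h : CE p j i) :
    Owns p j i := by
  refine CE.rec (p := p) (motive_1 := fun j i _ => Owns p j i)
    (motive_2 := fun j i _ => ¬ IsEntry (p.getD i default) → Owns p j i)
    ?_ ?_ ?_ ?_ ?_ h
  · exact fun i hi he => .entry hi he
  · rintro j (_ | i) hi h0 he hx _ ih
    · omega
    · exact ih.inner hp hi he hx
  · rintro j m (_ | i) hi h0 he hjm hmi hc hx _ _ ih ih'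
    · omega
    · exact Owns.ret hp hi he (by omega) hc hx ih (ih' (not_isEntry_of_isExitCEval hx))
  · exact fun j i _ ih _ => ih
  · exact fun j m i hmi ht he _ _ ih ih' hi =>
      .tail hp ht ih (ih' (not_isEntry_of_isTailCall ht)) hi

theorem CEstar.owns {pr : ULam} {p : List AState} (hp : IsPath pr p) {j i : ℕ}
    (h : CEstar p j i) (hi : ¬ IsEntry (p.getD i default)) : Owns p j i := by
  induction i using Nat.strong_induction_on generalizing j with
  | _ i ih =>
    cases h with
    | base _ _ h => exact h.owns hp
    | tail _ m _ hmi ht he h h' =>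
      exact .tail hp ht (h.owns hp) (ih m (by omega) h' (not_isEntry_of_isTailCall ht)) hi

theorem not_step_of_isFinal {pr : ULam} {s s' : AState} (h : IsFinal s) : ¬ AStep pr s s' := by
  intro hs
  cases hs <;> exact h

/-- Every non-final state of a path from the initial state has a corresponding entry, and some
element of its `CE*` is either the initial entry or is entered by a non-tail call. -/
theorem exists_CE {pr inp : ULam} {p : List AState} (hp : IsPath pr p)
    (h0 : p.getD 0 default = initA pr inp) (i : ℕ) (hi : i < p.length)
    (hf : ¬ IsFinal (p.getD i default)) :
    (∃ j, CE p j i) ∧ ∃ j, CEstar p j i ∧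
      (j = 0 ∨ ∃ m, j = m + 1 ∧ IsCall (p.getD m default)) := by
  induction i using Nat.strong_induction_on with
  | _ i ih =>
    have hCE : ∃ j, CE p j i := by
      by_cases he : IsEntry (p.getD i default)
      · exact ⟨i, .entry i hi he⟩
      · obtain _ | i := i
        · rw [h0] at he; exact absurd trivial he
        · have hs := hp i hi
          obtain ⟨⟨j, hj⟩, r, hr, hr'⟩ := ih i (by omega) (by omega) fun h =>
            not_step_of_isFinal h hs
          by_cases hx : IsExitCEval (p.getD i default)
          · have hown := hr.owns hp (not_isEntry_of_isExitCEval hx)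
            obtain ⟨f, d, c, st, h, hrj, hin⟩ := hown.inProc (not_isEntry_of_isExitCEval hx)
            obtain rfl | ⟨m, rfl, hc⟩ := hr'
            · rw [h0] at hrj
              cases hrj
              obtain ⟨d', h', hfin⟩ := hin.exit hs hx
              rw [hfin] at hf
              exact absurd trivial hf
            · have hmi := hown.1
              have hne : m + 1 ≠ i := by
                rintro rfl
                exact not_isEntry_of_isExitCEval hx (hrj ▸ trivial)
              obtain ⟨⟨j', hj'⟩, -⟩ := ih m (by omega) (by omega) fun h =>
                not_step_of_isFinal h (hp m (by omega))
              have hjm : j' ≠ m := by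
                rintro rfl
                obtain ⟨_, _, _, _, _, _, _, hjj, _⟩ := hj'.owns hp
                exact not_isEntry_of_isCall hc (hjj ▸ trivial)
              have := (hj'.owns hp).1
              exact ⟨j', .callret j' m (i + 1) hi (by omega) he (by omega) (by omega) hc hx hj' hr⟩
          · exact ⟨j, .inner j (i + 1) hi (by omega) he hx hj⟩
    refine ⟨hCE, ?_⟩
    obtain ⟨j, hj⟩ := hCE
    obtain ⟨hji, _, f, d, c, st, h, hje, -⟩ := hj.owns hp
    obtain _ | m := j
    · exact ⟨0, .base _ _ hj, .inl rfl⟩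
    · have hs := hp m (by omega)
      have hen : IsEntry (p.getD (m + 1) default) := by rw [hje]; trivial
      obtain hc | ht := hs.source_of_entry hen
      · exact ⟨m + 1, .base _ _ hj, .inr ⟨m, rfl, hc⟩⟩
      · obtain ⟨-, r, hr, hr'⟩ := ih m (by omega) (by omega) fun h => not_step_of_isFinal h hs
        exact ⟨r, .tail r m i hji ht hen hj hr, hr'⟩

/-! ### Re-entering the initial local state -/

def heapOf : AState → Heap
  | .eval _ _ h => h
  | .applyU _ _ _ _ h => h
  | .applyC _ _ _ h => h

theorem AStep.heapOf_eq_none {pr : ULam} {s s' : AState} (hs : AStep pr s s')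
    (h : heapOf s' = fun _ => none) : heapOf s = fun _ => none := by
  cases hs with
  | @uae_h u => have := congrFun h u; simp [heapOf, hjoin] at this
  | @cae_h u => have := congrFun h u; simp [heapOf, hjoin] at this
  | _ => exact h

/-- All user values in the frames and in the state itself are singletons. -/
def SingletonValues (s : AState) : Prop :=
  (∀ fr ∈ stackOf s, ∀ v d, fr.u v = some d → ∃ a, d = {a}) ∧
    match s with
    | .eval _ _ _ => True
    | .applyU _ d _ _ _ => ∃ a, d = {a}
    | .applyC _ d _ _ => ∃ a, d = {a}

theorem AEvalU.singleton {pr : ULam} {e : UExp} {l : Lab} {st : Stack} {h : Heap} {d : D}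
    (he : AEvalU pr e l st h d) (hh : h = fun _ => none)
    (hst : ∀ fr ∈ st, ∀ v d, fr.u v = some d → ∃ a, d = {a}) : ∃ a, d = {a} := by
  cases he with
  | lam => exact ⟨_, rfl⟩
  | stk v _ tf st _ d hv hd => exact hst tf (by simp) v d hd
  | hp _ _ _ _ _ hv hd => simp [hh] at hd

theorem SingletonValues.updU {fr : Frame} {st : Stack} {v : UVar} {d : D}
    (hst : ∀ fr' ∈ fr :: st, ∀ v d, fr'.u v = some d → ∃ a, d = {a}) (hd : ∃ a, d = {a}) :
    ∀ fr' ∈ fr.updU v d :: st, ∀ v d, fr'.u v = some d → ∃ a, d = {a} := by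
  intro fr' hfr' w d' hw
  obtain rfl | hm := List.mem_cons.1 hfr'
  · simp only [Frame.updU] at hw
    split_ifs at hw
    · cases hw; exact hd
    · exact hst fr (by simp) w d' hw
  · exact hst fr' (by simp [hm]) w d' hw

theorem SingletonValues.step {pr : ULam} {s s' : AState} (h : SingletonValues s)
    (hs : AStep pr s s') (hh : heapOf s = fun _ => none) : SingletonValues s' := by
  obtain ⟨hst, hd⟩ := h
  cases hs with
  | uea_tail _ _ he => exact ⟨fun fr hfr => hst fr (List.mem_cons_of_mem _ hfr), he.singleton hh hst⟩
  | uea_flam he => exact ⟨hst, he.singleton hh hst⟩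
  | uea_fheap _ _ _ he => exact ⟨hst, he.singleton hh hst⟩
  | uea_fstk _ _ _ he => exact ⟨SingletonValues.updU hst ⟨_, rfl⟩, he.singleton hh hst⟩
  | cea_var _ he => exact ⟨fun fr hfr => hst fr (List.mem_cons_of_mem _ hfr), he.singleton hh hst⟩
  | cea_lam he => exact ⟨hst, he.singleton hh hst⟩
  | cae_h => exact ⟨SingletonValues.updU hst hd, trivial⟩
  | cae_s => exact ⟨SingletonValues.updU hst hd, trivial⟩
  | _ =>
    refine ⟨fun fr hfr v d' hv => ?_, trivial⟩
    obtain rfl | hm := List.mem_cons.1 hfr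
    · simp only [mkFrame] at hv
      split_ifs at hv
      cases hv; exact hd
    · exact hst fr hm v d' hv

/-- `LiftStack c st S S'`: `S'` is `S` put on top of `st`, with the continuation `halt` of the
bottom frame of `S` replaced by `c`. -/
inductive LiftStack (c : CAbs) (st : Stack) : Stack → Stack → Prop
  | bottom (f f' : Frame) : f.u = f'.u → (∀ kv a, f.k kv = some a → a = .halt) →
      (∀ kv a, f'.k kv = some a → a = c) → LiftStack c st [f] (f' :: st)
  | cons (f : Frame) (S T : Stack) : LiftStack c st S T → LiftStack c st (f :: S) (f :: T)

/-- `LiftState c st s s'`: the state `s'` runs like `s`, above the stack `st` and the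
continuation `c`. -/
inductive LiftState (c : CAbs) (st : Stack) : AState → AState → Prop
  | eval (call : Call) (S S' : Stack) (h : Heap) : LiftStack c st S S' →
      LiftState c st (.eval call S h) (.eval call S' h)
  | applyU (f : ULam) (d : D) (cc : CAbs) (S S' : Stack) (h : Heap) : LiftStack c st S S' →
      LiftState c st (.applyU f d cc S h) (.applyU f d cc S' h)
  | applyC (cc : CAbs) (d : D) (S S' : Stack) (h : Heap) : LiftStack c st S S' →
      LiftState c st (.applyC cc d S h) (.applyC cc d S' h)
  | entry (f : ULam) (d : D) (h : Heap) :
      LiftState c st (.applyU f d .halt [] h) (.applyU f d c st h)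

theorem LiftState.heapOf_eq {c : CAbs} {st : Stack} {s s' : AState} (h : LiftState c st s s') :
    heapOf s' = heapOf s := by
  cases h <;> rfl

theorem LiftStack.topU_eq {c : CAbs} {st S S' : Stack} (h : LiftStack c st S S') :
    topU S' = topU S := by
  cases h with
  | bottom f f' hu => exact hu.symm
  | cons => rfl

theorem LiftStack.length_eq {c : CAbs} {st S S' : Stack} (h : LiftStack c st S S') :
    S'.length = S.length + st.length ∧ S ≠ [] := by
  induction h with
  | bottom => simp [add_comm]
  | cons _ _ _ _ ih => simp only [List.length_cons]; exact ⟨by omega, by simp⟩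

theorem LiftStack.eq_singleton {c : CAbs} {st S : Stack} {f : Frame}
    (h : LiftStack c st S (f :: st)) : ∃ f', S = [f'] := by
  have hl := h.length_eq.1
  rw [List.length_cons] at hl
  exact List.length_eq_one_iff.1 (by omega)

theorem LEvalU.unique {pr : ULam} {e : UExp} {l : Lab} {tf : LFrame} {h : Heap} {d d' : D}
    (h1 : LEvalU pr e l tf h d) (h2 : LEvalU pr e l tf h d') : d = d' := by
  cases h1 <;> cases h2 <;> simp_all

theorem LiftStack.eval_unique {pr : ULam} {c : CAbs} {st S S' : Stack} {e : UExp} {l : Lab}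
    {h : Heap} {d d' : D} (hl : LiftStack c st S S') (h1 : AEvalU pr e l S h d)
    (h2 : AEvalU pr e l S' h d') : d' = d :=
  h2.toLocal.unique (hl.topU_eq ▸ h1.toLocal)

theorem LiftStack.updU {c : CAbs} {st S S' : Stack} {f f' : Frame} {v : UVar} {d : D}
    (hl : LiftStack c st (f :: S) (f' :: S')) :
    LiftStack c st (f.updU v d :: S) (f'.updU v d :: S') := by
  cases hl with
  | bottom _ _ hu hk hk' => exact .bottom _ _ (by simp [Frame.updU, hu]) hk hk'
  | cons _ _ _ hl => exact .cons _ _ _ hl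

/-- Popping a lifted stack. -/
theorem LiftStack.pop {c : CAbs} {st S S' : Stack} {f f' : Frame} {kv : CVar} {a a' : CAbs}
    (hl : LiftStack c st (f :: S) (f' :: S')) (ha : f.k kv = some a) (ha' : f'.k kv = some a') :
    (a = a' ∧ LiftStack c st S S') ∨ (S = [] ∧ S' = st ∧ a = .halt ∧ a' = c) := by
  cases hl with
  | bottom _ _ hu hk hk' => exact .inr ⟨rfl, rfl, hk _ _ ha, hk' _ _ ha'⟩
  | cons _ _ _ hl => exact .inl ⟨Option.some.inj (ha.symm.trans ha'), hl⟩

theorem LiftState.step {pr : ULam} {c : CAbs} {st : Stack} {s s' t t' : AState}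
    (hl : LiftState c st s s') (hv : SingletonValues s) (hh : heapOf s = fun _ => none)
    (hs : AStep pr s t) (hs' : AStep pr s' t') :
    LiftState c st t t' ∨ ∃ cc d h, t = .applyC cc d [] h := by
  cases hl with
  | entry f d h =>
    refine .inl ?_
    cases hs <;> cases hs' <;> first | contradiction | skip
    all_goals exact .eval _ _ _ _ (.bottom _ _ rfl (by simp +contextual [mkFrame, eq_comm])
      (by simp +contextual [mkFrame, eq_comm]))
  | applyU f d cc S S' h hL =>
    refine .inl ?_
    cases hs <;> cases hs' <;> first | contradiction | skip
    all_goals exact .eval _ _ _ _ (.cons _ _ _ hL)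
  | applyC cc d S S' h hL =>
    refine .inl ?_
    cases hs <;> cases hs' <;> first | contradiction | skip
    all_goals exact .eval _ _ _ _ hL.updU
  | eval call S S' h hL =>
    cases hs with
    | uea_tail hf hu he hk =>
      cases hs' with
      | uea_tail hf' hu' he' hk' =>
        cases hL.eval_unique hf hf'
        cases hL.eval_unique he he'
        obtain ⟨a, rfl⟩ := hf.singleton hh hv.1
        cases hu; cases hu'
        obtain ⟨rfl, hL'⟩ | ⟨rfl, rfl, rfl, rfl⟩ := hL.pop hk hk'
        · exact .inl (.applyU _ _ _ _ _ _ hL')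
        · exact .inl (.entry _ _ _)
    | uea_flam he =>
      cases hs' with
      | uea_flam he' =>
        cases hL.eval_unique he he'
        exact .inl (.applyU _ _ _ _ _ _ hL)
    | uea_fheap hv' hf =>
      exact absurd hf (by have := congrFun hh; simp only [heapOf] at this; simp [this])
    | uea_fstk hv' hf hu he =>
      cases hs' with
      | uea_fheap hv'' => contradiction
      | uea_fstk _ hf' hu' he' =>
        cases hL.eval_unique he he'
        cases hL.eval_unique (.stk _ _ _ _ h _ hv' hf) (.stk _ _ _ _ h _ hv' hf')
        obtain ⟨a, rfl⟩ := hv.1 _ (by simp [stackOf]) _ _ hf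
        cases hu; cases hu'
        exact .inl (.applyU _ _ _ _ _ _ hL.updU)
    | cea_var hk he =>
      cases hs' with
      | cea_var hk' he' =>
        cases hL.eval_unique he he'
        obtain ⟨rfl, hL'⟩ | ⟨rfl, rfl, rfl, rfl⟩ := hL.pop hk hk'
        · exact .inl (.applyC _ _ _ _ _ hL')
        · exact .inr ⟨_, _, _, rfl⟩
    | cea_lam he =>
      cases hs' with
      | cea_lam he' =>
        cases hL.eval_unique he he'
        exact .inl (.applyC _ _ _ _ _ hL)

theorem not_step_of_applyC_nil {pr : ULam} {s : AState} {cc : CAbs} {d : D} {h : Heap} :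
    ¬ AStep pr (.applyC cc d [] h) s := by
  intro hs
  cases hs

/-- A later entry with the same local state as the initial one never reaches an exit of
its activation. -/
theorem not_isExitCEval_of_toLocal_eq {pr inp : ULam} {p : List AState} (hp : IsPath pr p)
    (h0 : p.getD 0 default = initA pr inp) {b i : ℕ} (hb : 0 < b)
    (hbl : toLocal (p.getD b default) = toLocal (initA pr inp)) (ho : Owns p b i) :
    ¬ IsExitCEval (p.getD i default) := by
  intro hx
  obtain ⟨f, d, c, st, h, hbe, hin⟩ := ho.inProc (not_isEntry_of_isExitCEval hx)
  obtain ⟨hbi, hi, -⟩ := ho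
  rw [hbe] at hbl
  cases hbl
  have hheap : ∀ k, k ≤ b → heapOf (p.getD k default) = fun _ => none := by
    intro k hk
    induction hk using Nat.decreasingInduction with
    | of_succ n hn ih => exact (hp n (by omega)).heapOf_eq_none ih
    | self => rw [hbe]; rfl
  have hsing : ∀ n, n < p.length → (∀ k ≤ n, heapOf (p.getD k default) = fun _ => none) →
      SingletonValues (p.getD n default) := by
    intro n hn hk
    induction n with
    | zero => rw [h0]; exact ⟨by simp [stackOf, initA], inp, rfl⟩
    | succ n ih =>
      exact (ih (by omega) fun k hkn => hk k (by omega)).step (hp n hn) (hk n (by omega))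
  have hlift : ∀ n, b + n < p.length → (∀ k ≤ b + n, heapOf (p.getD k default) = fun _ => none) ∧
      LiftState c st (p.getD n default) (p.getD (b + n) default) := by
    intro n hn
    induction n with
    | zero => exact ⟨hheap, by rw [h0, Nat.add_zero, hbe]; exact .entry _ _ _⟩
    | succ n ih =>
      obtain ⟨hk, hl⟩ := ih (by omega)
      obtain hl' | ⟨cc, d, h, hs⟩ := hl.step (hsing n (by omega) fun k hkn => hk k (by omega))
        (hk n (by omega)) (hp n (by omega)) (hp (b + n) hn)
      · refine ⟨fun k hkn => ?_, hl'⟩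
        obtain hlt | rfl := Nat.lt_or_eq_of_le hkn
        · exact hk k (by omega)
        · exact hl'.heapOf_eq.trans (hk _ (by omega))
      · have := hp (n + 1) (by omega)
        rw [hs] at this
        exact absurd this not_step_of_applyC_nil
  obtain ⟨n, rfl⟩ := Nat.exists_eq_add_of_le hbi
  obtain ⟨-, hl⟩ := hlift n hi
  have hs := hp n (by omega)
  obtain ⟨_, fr, hfr, hst⟩ := hin
  have key : ∃ cc d h, p.getD (n + 1) default = .applyC cc d [] h := by
    generalize p.getD n default = s at *
    generalize p.getD (n + 1) default = s1 at *
    generalize p.getD (b + n) default = s' at *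
    cases hl with
    | eval call S S' h hL =>
      cases hs with
      | cea_var hk he =>
        cases hst
        obtain ⟨_, hf⟩ := hL.eq_singleton
        cases hf
        exact ⟨_, _, _, rfl⟩
      | _ => exact hx.elim
    | _ => exact hx.elim
  obtain ⟨cc, d, h, hn⟩ := key
  by_cases hlt : n + 2 < p.length
  · have := hp (n + 1) hlt
    rw [hn] at this
    exact not_step_of_applyC_nil this
  · have : b + n = n + 1 := by omega
    rw [this, hn] at hx
    exact hx


/-! ### Soundness -/

theorem AStep.entry_of_source {pr : ULam} {s s' : AState} (hs : AStep pr s s')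
    (h : IsCall s ∨ IsTailCall s) : IsEntry s' := by
  cases hs <;> simp_all [IsEntry, IsCall, IsTailCall]

theorem not_isExitCEval_of_source {s : AState} (h : IsCall s ∨ IsTailCall s) :
    ¬ IsExitCEval s := by
  rcases s with ⟨⟨l, f, ex, q | k⟩ | ⟨g, q | k, ex⟩, st, h⟩ | ⟨f, d, cc, st, h⟩ | ⟨cc, d, st, h⟩ <;>
    simp_all [IsExitCEval, IsCall, IsTailCall]

/-- An edge from the corresponding entry to an exit extends along tail calls to `CE*`. -/
theorem seen_of_CEstar {pr inp : ULam} {p : List AState} (hp : IsPath pr p)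
    (h0 : p.getD 0 default = initA pr inp) {c : Config}
    (inv : AlgoInv pr (toLocal (initA pr inp)) c)
    (hP : Processed pr (toLocal (initA pr inp)) c c.Seen) {i : ℕ}
    (hx : IsExitCEval (p.getD i default))
    (ih : ∀ m < i, ∀ j, CE p j m →
      (toLocal (p.getD j default), toLocal (p.getD m default)) ∈ c.Seen)
    {k j : ℕ} (hki : k ≤ i) (hj : CEstar p j k)
    (hk : ∀ e, CE p e k →
      (toLocal (p.getD e default), toLocal (p.getD i default)) ∈ c.Seen ∧ Owns p e i) :
    (toLocal (p.getD j default), toLocal (p.getD i default)) ∈ c.Seen := by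
  induction k using Nat.strong_induction_on generalizing j with
  | _ k ihk =>
    cases hj with
    | base _ _ h => exact (hk j h).1
    | tail _ m _ hmk ht he h h' =>
      obtain ⟨hseen, hown⟩ := hk _ h
      have hi := hown.2.1
      have hsum := hP.exit_summary _ _ hseen (toLocal_isExitCEval hx) fun heq =>
        not_isExitCEval_of_toLocal_eq hp h0 m.succ_pos heq hown hx
      have hs := (hp m (by omega)).toLocal (not_isExitCEval_of_source (.inr ht))
      refine ihk m (by omega) (by omega) h' fun e hem => ⟨?_, ?_⟩
      · exact inv.tail_update _ _ _ _
          (hP.tail_callers _ _ _ (ih m (by omega) e hem) (toLocal_isTailCall ht) hs) hsum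
      · exact .tail hp ht hown (hem.owns hp) (not_isEntry_of_isExitCEval hx)

theorem seen_of_CE {pr inp : ULam} {p : List AState} (hp : IsPath pr p)
    (h0 : p.getD 0 default = initA pr inp) {c : Config}
    (inv : AlgoInv pr (toLocal (initA pr inp)) c)
    (hP : Processed pr (toLocal (initA pr inp)) c c.Seen) {i j : ℕ} (hj : CE p j i) :
    (toLocal (p.getD j default), toLocal (p.getD i default)) ∈ c.Seen := by
  induction i using Nat.strong_induction_on generalizing j with
  | _ i ih =>
    have hstar : ∀ k < i, IsExitCEval (p.getD k default) → ∀ j, CEstar p j k →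
        (toLocal (p.getD j default), toLocal (p.getD k default)) ∈ c.Seen :=
      fun k hki hx j hj => seen_of_CEstar hp h0 inv hP hx (fun m hm j => ih m (by omega)) le_rfl hj
        fun e he => ⟨ih k hki he, he.owns hp⟩
    cases hj with
    | entry _ hi he =>
      obtain _ | i := i
      · rw [h0]; exact inv.init_seen
      · have hs := hp i hi
        have hsrc := hs.source_of_entry he
        obtain ⟨⟨e, hei⟩, -⟩ := exists_CE hp h0 i (by omega) fun h => not_step_of_isFinal h hs
        exact hP.call_entry _ _ _ (ih i (by omega) hei)
          (hsrc.imp toLocal_isCall toLocal_isTailCall)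
          (hs.toLocal (not_isExitCEval_of_source hsrc))
    | inner _ _ hi hpos he hx h =>
      obtain _ | i := i
      · omega
      · have hs := hp i hi
        have hc := fun hc => he (hs.entry_of_source hc)
        exact hP.step _ _ _ (ih i (by omega) h)
          (toLocal_isInner hx (fun h => hc (.inl h)) fun h => hc (.inr h)) (hs.toLocal hx)
    | callret _ m _ hi hpos he hjm hmi hc hx h h' =>
      obtain _ | i := i
      · omega
      · simp only [Nat.add_sub_cancel] at hx h'
        have hown := h'.owns hp (not_isEntry_of_isExitCEval hx)
        have hsm := hp m (by omega)
        have hsum := hP.exit_summary _ _ (hstar i (by omega) hx _ h') (toLocal_isExitCEval hx)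
          fun heq => not_isExitCEval_of_toLocal_eq hp h0 m.succ_pos heq hown hx
        have hcall := hP.call_callers _ _ _ (ih m (by omega) h) (toLocal_isCall hc)
          (hsm.toLocal (not_isExitCEval_of_source (.inl hc)))
        obtain ⟨_, _, f, d, a, st, hh, hje, -⟩ := h.owns hp
        obtain ⟨f', d', a', st', hh', hme, hin⟩ :=
          hown.inProc (not_isEntry_of_isExitCEval hx)
        refine inv.update _ _ _ _ _ hcall hsum ?_
        rw [hme] at hsm
        rw [hje, hme]
        exact .of_return hx hsm hc (hp i hi) hin

/-- A final state is the result of an exit whose `CE*` contains the initial entry. -/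
theorem CEstar_zero_of_isFinal {pr inp : ULam} {p : List AState} (hp : IsPath pr p)
    (h0 : p.getD 0 default = initA pr inp) {i : ℕ} (hi : i + 1 < p.length)
    (hf : IsFinal (p.getD (i + 1) default)) :
    IsExitCEval (p.getD i default) ∧ CEstar p 0 i := by
  have hs := hp i hi
  have hx : IsExitCEval (p.getD i default) := by
    revert hf
    generalize p.getD i default = s, p.getD (i + 1) default = s' at hs
    cases hs <;> simp [IsFinal, IsExitCEval]
  refine ⟨hx, ?_⟩
  obtain ⟨-, r, hr, hr'⟩ := exists_CE hp h0 i (by omega) fun h => not_step_of_isFinal h hs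
  obtain rfl | ⟨m, rfl, hc⟩ := hr'
  · exact hr
  · have hown := hr.owns hp (not_isEntry_of_isExitCEval hx)
    have hmi := hown.1
    have hsm := hp m (by omega)
    obtain ⟨f, d, a, st, h, hme, hin⟩ := hown.inProc (not_isEntry_of_isExitCEval hx)
    obtain ⟨⟨e, hem⟩, -⟩ := exists_CE hp h0 m (by omega) fun h => not_step_of_isFinal h hsm
    obtain ⟨_, _, _, _, _, -, hin'⟩ := (hem.owns hp).inProc (not_isEntry_of_isCall hc)
    obtain ⟨_, _, _, _, _, hme', -⟩ := hin'.call hsm hc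
    rw [hme] at hme'
    cases hme'
    obtain ⟨_, _, hret⟩ := hin.exit hs hx
    rw [hret] at hf
    exact hf.elim

theorem summarization_sound (pr inp : ULam)
    (p : List AState) (hne : p ≠ [])
    (hchain : p.Chain' (AStep pr))
    (hhead : p.head? = some (initA pr inp))
    (c : Config)
    (hreach : Relation.ReflTransGen (AlgoStep pr (toLocal (initA pr inp)))
      (initConfig (toLocal (initA pr inp))) c)
    (hterm : c.W = ∅)
    (sf : AState) (hlast : p.getLast? = some sf) :
    -- (1) non-final states: the edge from the corresponding entry is Seen
    (¬ IsFinal sf → ∀ j, CE p j (p.length - 1) →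
        (toLocal (p.getD j default), toLocal sf) ∈ c.Seen) ∧
    -- (2) final states are recorded in Final
    (IsFinal sf → toLocal sf ∈ c.Final) ∧
    -- (3) Exit-CEvals: edges from every state in CE* are Seen
    (IsExitCEval sf → ∀ j, CEstar p j (p.length - 1) →
        (toLocal (p.getD j default), toLocal sf) ∈ c.Seen) := by
  have inv := AlgoInv.of_reachable hreach
  have hP : Processed pr (toLocal (initA pr inp)) c c.Seen := by
    simpa [hterm] using inv.processed
  have hp : IsPath pr p := by
    intro i hi
    rw [List.getD_eq_getElem _ _ hi, List.getD_eq_getElem _ _ (Nat.lt_of_succ_lt hi)]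
    exact List.isChain_iff_getElem.1 hchain i hi
  have h0 : p.getD 0 default = initA pr inp := by
    rw [List.getD_eq_getElem?_getD, ← List.head?_eq_getElem?, hhead, Option.getD_some]
  obtain rfl : p.getD (p.length - 1) default = sf := by
    rw [List.getD_eq_getElem?_getD, ← List.getLast?_eq_getElem?, hlast, Option.getD_some]
  have hstar : ∀ i, IsExitCEval (p.getD i default) → ∀ j, CEstar p j i →
      (toLocal (p.getD j default), toLocal (p.getD i default)) ∈ c.Seen :=
    fun i hx j hj => seen_of_CEstar hp h0 inv hP hx (fun _ _ _ => seen_of_CE hp h0 inv hP) le_rfl hj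
      fun e he => ⟨seen_of_CE hp h0 inv hP he, he.owns hp⟩
  refine ⟨fun _ j hj => seen_of_CE hp h0 inv hP hj, fun hf => ?_, hstar _⟩
  have hpos := List.length_pos_of_ne_nil hne
  obtain ⟨i, hi⟩ : ∃ i, p.length = i + 1 := ⟨p.length - 1, by omega⟩
  rw [hi, Nat.add_sub_cancel] at hf ⊢
  obtain _ | i := i
  · rw [h0] at hf; exact hf.elim
  obtain ⟨hx, hz⟩ := CEstar_zero_of_isFinal hp h0 (by omega) hf
  have hseen := hstar i hx 0 hz
  have hs := hp i (by omega)
  rw [h0] at hseen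
  generalize p.getD i default = s, p.getD (i + 1) default = s' at *
  cases hs with
  | @cea_var a _ _ _ st _ _ _ _ hd =>
    cases a with
    | clam => exact hf.elim
    | halt =>
      cases st with
      | cons => exact hf.elim
      | nil => exact hP.exit_final _ _ _ _ _ _ hseen hd.toLocal
  | _ => exact hx.elim

end CFA2
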